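/- Let χ_n := (1 + (−1)ⁿ)/2 (so χ_n = 1 for even n and 0 for odd n) and χ_{n+1} = (1 − (−1)ⁿ)/2. Let u : ℤ → ℝ → ℝ be such that each u_n is differentiable, u_{n+1}(t) ≠ u_{n−1}(t) for all n ∈ ℤ and t ∈ ℝ, and u solves the GYdKN example equation du_n/dt = (χ_{n+1}(u_{n+1} + u_{n−1}) + 2χ_n u_n)/(u_{n+1} − u_{n−1}). Then each of the following again satisfies v_{n+1}(t) ≠ v_{n−1}(t) and solves the same equation: (i) v_n(t) = s·u_n(t/s) for any s ≠ 0; (ii) v_n(t) = u_n(t) + ε·χ_{n+1} for any ε ∈ ℝ (i.e. u_n shifted by ε at odd n); (iii) v_n(t) = s^{χ_n}·u_n(t) for any s > 0 (i.e. u_n multiplied by s at even n). These are the one-parameter groups generated by X₁ = t∂_t + u_n∂_{u_n}, X₂ = χ_{n+1}∂_{u_n}, X₃ = χ_n u_n∂_{u_n}. -/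

import Mathlib

/-- χ_n = (1 + (−1)ⁿ)/2: equal to 1 for even n and 0 for odd n. -/
noncomputable def chi (n : ℤ) : ℝ := (1 + (-1 : ℝ) ^ n) / 2

/-- `u` solves the GYdKN example equation
du_n/dt = (χ_{n+1}(u_{n+1} + u_{n−1}) + 2χ_n u_n)/(u_{n+1} − u_{n−1}). -/
def SolvesGYdKNex (u : ℤ → ℝ → ℝ) : Prop :=
  ∀ (n : ℤ) (t : ℝ),
    HasDerivAt (u n)
      ((chi (n + 1) * (u (n + 1) t + u (n - 1) t) + 2 * chi n * u n t)
       / (u (n + 1) t - u (n - 1) t)) t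

/-- `v` is again admissible: neighbours stay distinct and it solves the same equation. -/
def GoodGYdKNex (v : ℤ → ℝ → ℝ) : Prop :=
  (∀ (n : ℤ) (t : ℝ), v (n + 1) t ≠ v (n - 1) t) ∧ SolvesGYdKNex v

theorem chi_of_even {n : ℤ} (h : Even n) : chi n = 1 := by
  simp [chi, h.neg_one_zpow]

theorem chi_of_odd {n : ℤ} (h : Odd n) : chi n = 0 := by
  simp [chi, h.neg_one_zpow]

theorem GoodGYdKNex.scale {u : ℤ → ℝ → ℝ} (hu : GoodGYdKNex u) {s : ℝ} (hs : s ≠ 0) :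
    GoodGYdKNex (fun n t => s * u n (t / s)) := by
  refine ⟨fun n t h => hu.1 n (t / s) (mul_left_cancel₀ hs h), fun n t => ?_⟩
  have hd := sub_ne_zero.2 (hu.1 n (t / s))
  refine (((hu.2 n (t / s)).comp t ((hasDerivAt_id t).div_const s)).const_mul s).congr_deriv ?_
  simp only [← mul_sub]
  field_simp

theorem GoodGYdKNex.shift_odd {u : ℤ → ℝ → ℝ} (hu : GoodGYdKNex u) (ε : ℝ) :
    GoodGYdKNex (fun n t => u n t + ε * chi (n + 1)) := by
  have hchi (n : ℤ) : chi (n + 1 + 1) = chi n := by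
    rcases Int.even_or_odd n with h | h
    · rw [chi_of_even h, chi_of_even h.add_one.add_one]
    · rw [chi_of_odd h, chi_of_odd h.add_one.add_one]
  refine ⟨fun n t h => hu.1 n t ?_, fun n t => ?_⟩
  · simpa [hchi] using h
  · refine ((hu.2 n t).add_const (ε * chi (n + 1))).congr_deriv ?_
    rcases Int.even_or_odd n with h | h
    · simp [hchi, chi_of_even h, chi_of_odd h.add_one]
    · simp [hchi, chi_of_odd h]

theorem GoodGYdKNex.scale_even {u : ℤ → ℝ → ℝ} (hu : GoodGYdKNex u) {s : ℝ} (hs : 0 < s) :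
    GoodGYdKNex (fun n t => s ^ chi n * u n t) := by
  have hchi (n : ℤ) : chi (n - 1) = chi (n + 1) := by
    rcases Int.even_or_odd n with h | h
    · rw [chi_of_odd h.add_one, chi_of_odd (h.sub_odd odd_one)]
    · rw [chi_of_even h.add_one, chi_of_even (h.sub_odd odd_one)]
  refine ⟨fun n t h => hu.1 n t ?_, fun n t => ?_⟩
  · simp only [hchi] at h
    exact mul_left_cancel₀ (Real.rpow_pos_of_pos hs _).ne' h
  · have hd := sub_ne_zero.2 (hu.1 n t)
    refine ((hu.2 n t).const_mul (s ^ chi n)).congr_deriv ?_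
    rcases Int.even_or_odd n with h | h
    · simp only [hchi, chi_of_even h, chi_of_odd h.add_one, Real.rpow_zero, Real.rpow_one]
      ring
    · simp only [hchi, chi_of_odd h, chi_of_even h.add_one, Real.rpow_zero, Real.rpow_one,
        ← mul_sub]
      field_simp
      ring

theorem gydkn_example_symmetry_groups (u : ℤ → ℝ → ℝ)
    (hneq : ∀ (n : ℤ) (t : ℝ), u (n + 1) t ≠ u (n - 1) t)
    (hsol : SolvesGYdKNex u) :
    (∀ s : ℝ, s ≠ 0 → GoodGYdKNex (fun n t => s * u n (t / s))) ∧
    (∀ ε : ℝ, GoodGYdKNex (fun n t => u n t + ε * chi (n + 1))) ∧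
    (∀ s : ℝ, 0 < s → GoodGYdKNex (fun n t => s ^ chi n * u n t)) := by
  have hu : GoodGYdKNex u := ⟨hneq, hsol⟩
  exact ⟨fun _ hs => hu.scale hs, hu.shift_odd, fun _ hs => hu.scale_even hs⟩
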